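/- Every simple representation of the category N of noncommutative finite sets factors through the category of finite sets: if V is a simple N-representation over a field k and p, q : [n] → [n'] are two N-morphisms with the same underlying set map, then the induced linear maps Vp and Vq : V[n] → V[n'] are equal. -/

import Mathlib

/-- A morphism in the category `N` of noncommutative finite sets: a function `toFun`
together with a linear order on each of its fibers, encoded as a relation `ord`
which only relates elements in a common fiber and is reflexive, antisymmetric,
transitive and total on each fiber. -/
structure NMor (X Y : Type) : Type where
  toFun : X → Y
  ord : X → X → Prop
  fiber : ∀ x x', ord x x' → toFun x = toFun x'
  refl : ∀ x, ord x x
  antisymm : ∀ x x', ord x x' → ord x' x → x = x'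
  trans : ∀ a b c, ord a b → ord b c → ord a c
  total : ∀ x x', toFun x = toFun x' → ord x x' ∨ ord x' x

/-- A representation of the category `N` of noncommutative finite sets over a field
`k`, valued in finite-dimensional `k`-vector spaces.  `V n` is the value at the
finite set `[n+1] = Fin (n+1)`; `act` is functorial for identities and for the
lexicographic composition of `N`. -/
structure NRep (k : Type) [Field k] : Type 1 where
  V : ℕ → Type
  [instAdd : ∀ n, AddCommGroup (V n)]
  [instMod : ∀ n, Module k (V n)]
  [instFin : ∀ n, FiniteDimensional k (V n)]
  act : ∀ {m n : ℕ}, NMor (Fin (m + 1)) (Fin (n + 1)) → (V m →ₗ[k] V n)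
  act_id : ∀ (n : ℕ) (e : NMor (Fin (n + 1)) (Fin (n + 1))),
    e.toFun = id → act e = LinearMap.id
  act_comp : ∀ {a b c : ℕ} (f : NMor (Fin (a + 1)) (Fin (b + 1)))
    (g : NMor (Fin (b + 1)) (Fin (c + 1))) (h : NMor (Fin (a + 1)) (Fin (c + 1))),
    h.toFun = g.toFun ∘ f.toFun →
    (∀ x x', h.ord x x' ↔
      ((g.ord (f.toFun x) (f.toFun x') ∧ f.toFun x ≠ f.toFun x') ∨
        (f.toFun x = f.toFun x' ∧ f.ord x x'))) →
    act h = (act g).comp (act f)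

attribute [instance] NRep.instAdd NRep.instMod NRep.instFin

variable {k : Type} [Field k]

/-- A family of subspaces closed under all the operations of an `N`-representation. -/
def IsSubrep (R : NRep k) (W : ∀ n, Submodule k (R.V n)) : Prop :=
  ∀ {m n : ℕ} (f : NMor (Fin (m + 1)) (Fin (n + 1))), ∀ v ∈ W m, R.act f v ∈ W n

/-- An `N`-representation is simple if it is nonzero and has no nonzero proper
subrepresentation. -/
def IsSimpleNRep (R : NRep k) : Prop :=
  (∃ (n : ℕ) (v : R.V n), v ≠ 0) ∧
  ∀ W : ∀ n, Submodule k (R.V n), IsSubrep R W →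
    (∀ n, W n = ⊥) ∨ (∀ n, W n = ⊤)

/-- The morphism of `N` determined by a bijection (each fiber of a bijection is a
singleton, so carries a unique linear order). -/
def permMor {n : ℕ} (σ : Equiv.Perm (Fin (n + 1))) :
    NMor (Fin (n + 1)) (Fin (n + 1)) where
  toFun := σ
  ord x x' := x = x'
  fiber _ _ h := by rw [h]
  refl _ := rfl
  antisymm _ _ h _ := h
  trans _ _ _ h1 h2 := h1.trans h2
  total _ _ h := Or.inl (σ.injective h)

/-- The subspace of `Sₙ`-invariant vectors of an `N`-representation at `[n+1]`,
where the symmetric group acts through the bijections of `N`. -/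
def NInv (R : NRep k) (n : ℕ) : Submodule k (R.V n) :=
  ⨅ σ : Equiv.Perm (Fin (n + 1)), LinearMap.ker (R.act (permMor σ) - LinearMap.id)

/-- Lexicographic composition of morphisms of noncommutative sets. -/
def NMor.comp {X Y Z : Type} (g : NMor Y Z) (f : NMor X Y) : NMor X Z where
  toFun := g.toFun ∘ f.toFun
  ord x x' := (g.ord (f.toFun x) (f.toFun x') ∧ f.toFun x ≠ f.toFun x') ∨
    (f.toFun x = f.toFun x' ∧ f.ord x x')
  fiber x x' h := by
    rcases h with h | h
    · exact g.fiber _ _ h.1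
    · exact congrArg g.toFun h.1
  refl x := Or.inr ⟨rfl, f.refl x⟩
  antisymm x x' h h' := by
    rcases h with ⟨h, hne⟩ | ⟨he, h⟩ <;> rcases h' with ⟨h', hne'⟩ | ⟨he', h'⟩
    · exact absurd (g.antisymm _ _ h h') hne
    · exact absurd he'.symm hne
    · exact absurd he.symm hne'
    · exact f.antisymm _ _ h h'
  trans a b c h h' := by
    rcases h with ⟨h, hne⟩ | ⟨he, h⟩ <;> rcases h' with ⟨h', hne'⟩ | ⟨he', h'⟩
    · refine Or.inl ⟨g.trans _ _ _ h h', fun hac => hne ?_⟩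
      exact g.antisymm _ _ h (hac ▸ h')
    · exact Or.inl ⟨he' ▸ h, he' ▸ hne⟩
    · exact Or.inl ⟨he ▸ h', he ▸ hne'⟩
    · exact Or.inr ⟨he.trans he', f.trans _ _ _ h h'⟩
  total x x' h := by
    by_cases he : f.toFun x = f.toFun x'
    · exact (f.total x x' he).imp (fun h => Or.inr ⟨he, h⟩) fun h => Or.inr ⟨he.symm, h⟩
    · exact (g.total _ _ h).imp (fun h => Or.inl ⟨h, he⟩) fun h => Or.inl ⟨h, Ne.symm he⟩

/-- If `p` is injective on the image of `s`, the order on the fibers of `p ∘ s` is that of `s`. -/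
theorem NMor.comp_ord_iff_of_injOn {X Y Z : Type} {p : NMor Y Z} {s : NMor X Y}
    (hp : Set.InjOn p.toFun (Set.range s.toFun)) (x x' : X) :
    (p.comp s).ord x x' ↔ s.ord x x' := by
  constructor
  · rintro (⟨h, hne⟩ | ⟨-, h⟩)
    · exact absurd (hp ⟨x, rfl⟩ ⟨x', rfl⟩ (p.fiber _ _ h)) hne
    · exact h
  · exact fun h => Or.inr ⟨s.fiber _ _ h, h⟩

namespace NRep

theorem act_act (R : NRep k) {a b c : ℕ} (g : NMor (Fin (b + 1)) (Fin (c + 1)))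
    (f : NMor (Fin (a + 1)) (Fin (b + 1))) (v : R.V a) :
    R.act g (R.act f v) = R.act (g.comp f) v := by
  rw [R.act_comp f g (g.comp f) rfl fun _ _ => Iff.rfl, LinearMap.comp_apply]

/-- The vectors on which any two morphisms with the same underlying map agree. -/
def commutativePart (R : NRep k) (m : ℕ) : Submodule k (R.V m) where
  carrier := {v | ∀ (n : ℕ) (p q : NMor (Fin (m + 1)) (Fin (n + 1))),
    p.toFun = q.toFun → R.act p v = R.act q v}
  add_mem' hv hw n p q h := by rw [map_add, map_add, hv n p q h, hw n p q h]
  zero_mem' n p q _ := by rw [map_zero, map_zero]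
  smul_mem' c v hv n p q h := by rw [map_smul, map_smul, hv n p q h]

theorem isSubrep_commutativePart (R : NRep k) : IsSubrep R R.commutativePart := by
  intro m n f v hv l p q h
  rw [act_act, act_act]
  exact hv l _ _ (congrArg (· ∘ f.toFun) h)

theorem act_comp_eq_of_injOn (R : NRep k) {a b c : ℕ}
    {p q : NMor (Fin (b + 1)) (Fin (c + 1))} (hpq : p.toFun = q.toFun)
    {s : NMor (Fin (a + 1)) (Fin (b + 1))}
    (hp : Set.InjOn p.toFun (Set.range s.toFun)) :
    R.act (p.comp s) = R.act (q.comp s) := by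
  rw [R.act_comp s q (q.comp s) rfl fun _ _ => Iff.rfl]
  refine R.act_comp s q (p.comp s) (congrArg (· ∘ s.toFun) hpq) fun x x' => ?_
  rw [NMor.comp_ord_iff_of_injOn hp]
  exact (NMor.comp_ord_iff_of_injOn (hpq ▸ hp) x x').symm

/-- If the commutative part vanishes, then so does the whole representation: a morphism of
minimal rank acting by a nonzero map would take values in the commutative part. -/
theorem act_eq_zero_of_commutativePart_eq_bot (R : NRep k)
    (h : ∀ n, R.commutativePart n = ⊥) {a b : ℕ} (s : NMor (Fin (a + 1)) (Fin (b + 1))) :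
    R.act s = 0 := by
  induction hr : (Set.range s.toFun).ncard using Nat.strong_induction_on generalizing b with
  | _ r ih =>
    subst hr
    ext v
    have hmem : R.act s v ∈ R.commutativePart b := by
      intro c p q hpq
      rw [act_act, act_act]
      by_cases hp : Set.InjOn p.toFun (Set.range s.toFun)
      · rw [act_comp_eq_of_injOn R hpq hp]
      · have hlt : (p.toFun '' Set.range s.toFun).ncard < (Set.range s.toFun).ncard :=
          lt_of_le_of_ne (Set.ncard_image_le (Set.toFinite _))
            fun he => hp (Set.injOn_of_ncard_image_eq he (Set.toFinite _))
        rw [← Set.range_comp] at hlt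
        have hlt' := hlt
        rw [hpq] at hlt'
        rw [ih _ hlt (p.comp s) rfl, ih _ hlt' (q.comp s) rfl]
    rw [h, Submodule.mem_bot] at hmem
    simpa using hmem

end NRep

/-- every simple `N`-representation factors through the category of
finite sets: two `N`-morphisms with the same underlying set map act by the same
linear map on a simple representation. -/
theorem stmt_10 (R : NRep k) (hsimple : IsSimpleNRep R) {n n' : ℕ}
    (p q : NMor (Fin (n + 1)) (Fin (n' + 1))) (hpq : p.toFun = q.toFun) :
    R.act p = R.act q := by
  rcases hsimple.2 _ R.isSubrep_commutativePart with h | h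
  · obtain ⟨m, v, hv⟩ := hsimple.1
    refine absurd ?_ hv
    rw [← LinearMap.id_apply (R := k) v, ← R.act_id m (permMor (Equiv.refl _)) rfl,
      R.act_eq_zero_of_commutativePart_eq_bot h, LinearMap.zero_apply]
  · ext v
    exact (h n ▸ Submodule.mem_top : v ∈ R.commutativePart n) n' p q hpq
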